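/- Fix an integer n ≥ 3 and 0 < h < 1/2. If (δ,γ) solves the system at (n,h), then μ_h^n = S^n + δ². -/

import Mathlib

open MeasureTheory Real Set Filter

noncomputable section

/-- `u ∈ H¹(0,1)` with weak derivative `u'`: `u` is continuous on `[0,1]`,
`u'` is (square-)integrable on `(0,1)`, and `u(x) = u(0) + ∫₀ˣ u'`. -/
def IsH1 (u u' : ℝ → ℝ) : Prop :=
  ContinuousOn u (Set.Icc 0 1) ∧
  IntervalIntegrable u' volume 0 1 ∧
  IntegrableOn (fun t => u' t ^ 2) (Set.Ioo 0 1) ∧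
  ∀ x ∈ Set.Icc (0:ℝ) 1, u x = u 0 + ∫ t in (0:ℝ)..x, u' t

/-- `f_m(h) = (1/m)·Σ_{k=0}^{m−1} (1−h)^{2−n+k}` (for the fixed dimension `n`). -/
def fm (n m : ℕ) (h : ℝ) : ℝ :=
  (1 / (m : ℝ)) * ∑ k ∈ Finset.range m, (1 - h) ^ ((2 : ℤ) - (n : ℤ) + (k : ℤ))

/-- `g_n(h) = f_n(h) − 2 f_{n−1}(h) + f_{n−2}(h)`. -/
def gn (n : ℕ) (h : ℝ) : ℝ := fm n n h - 2 * fm n (n - 1) h + fm n (n - 2) h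

/-- `(δ,γ)` solves the system at `(n,h)`. -/
def SolvesSystem (n : ℕ) (h δ γ : ℝ) : Prop :=
  0 < δ ∧ 4 * δ ^ 2 ≤ (n : ℝ) * ((n : ℝ) - 2) ∧
  (∀ r ∈ Set.Icc h (1 - h), γ + δ * Real.log r ∈ Set.Ioo (-(π/2)) (π/2)) ∧
  (((n : ℝ) ^ 2 - 2 * (n : ℝ)) / 2 - 2 * δ ^ 2)
      * ((n : ℝ) ^ 2 / 4 - δ ^ 2 + (n : ℝ) * δ * Real.tan (γ + δ * Real.log h))
    = (((n : ℝ) - 2) / ((n : ℝ) - 1)) * ((n : ℝ) ^ 2 / 4 + δ ^ 2) ^ 2 ∧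
  ((n : ℝ) - 2) / 2 + δ * Real.tan (γ + δ * Real.log (1 - h))
    = (1 / h) * (fm n n h - gn n h * (((n : ℝ) - 2) ^ 2 / 4 + δ ^ 2))

/-- `v ∈ W_h` (with weak derivative `v'`): `v ∈ H¹(0,1)`, `v(1) = 0`, and `v` is
affine on `[0,h]` and on `[1−h,1]`. -/
def MemWh (h : ℝ) (v v' : ℝ → ℝ) : Prop :=
  IsH1 v v' ∧ v 1 = 0 ∧
  (∃ a b : ℝ, ∀ x ∈ Set.Icc (0:ℝ) h, v x = a * x + b) ∧
  (∃ a b : ℝ, ∀ x ∈ Set.Icc (1 - h) (1:ℝ), v x = a * x + b)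

/-- `μ_h^n`: the infimum of the weighted Hardy Rayleigh quotient over nonzero `v ∈ W_h`. -/
def munh (n : ℕ) (h : ℝ) : ℝ :=
  sInf { s : ℝ | ∃ v v' : ℝ → ℝ, MemWh h v v' ∧ (∃ x ∈ Set.Icc (0:ℝ) 1, v x ≠ 0) ∧
    s = (∫ r in (0:ℝ)..1, r ^ (n - 1) * (v' r) ^ 2)
        / (∫ r in (0:ℝ)..1, r ^ (n - 3) * (v r) ^ 2) }


lemma ae_deriv {v v' : ℝ → ℝ} (H : IsH1 v v') :
    ∀ᵐ x : ℝ, x ∈ Ioo (0:ℝ) 1 → HasDerivAt v (v' x) x := by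
  obtain ⟨hc, hi, hi2, heq⟩ := H
  filter_upwards [hi.ae_hasDerivAt_integral] with x hx hx01
  have h01 : x ∈ uIcc (0:ℝ) 1 := by rw [uIcc_of_le zero_le_one]; exact Ioo_subset_Icc_self hx01
  have h1 := (hx h01 0 (by simp)).const_add (v 0)
  refine h1.congr_of_eventuallyEq ?_
  filter_upwards [Ioo_mem_nhds hx01.1 hx01.2] with y hy
  exact heq y (Ioo_subset_Icc_self hy)

lemma affine_ae {v v' : ℝ → ℝ} (H : IsH1 v v') {p q a b : ℝ} (hp : 0 ≤ p) (hq : q ≤ 1)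
    (hv : ∀ x ∈ Icc p q, v x = a * x + b) :
    ∀ᵐ x : ℝ, x ∈ Ioc p q → v' x = a := by
  filter_upwards [ae_deriv H, (volume : Measure ℝ).ae_ne q] with x hx hxq hxI
  have hlt : x < q := lt_of_le_of_ne hxI.2 hxq
  have h1 := hx ⟨lt_of_le_of_lt hp hxI.1, lt_of_lt_of_le hlt hq⟩
  have h2 : HasDerivAt v (a * 1) x := by
    refine (((hasDerivAt_id x).const_mul a).add_const b).congr_of_eventuallyEq ?_
    filter_upwards [Ioo_mem_nhds hxI.1 hlt] with y hy
    exact hv y (Ioo_subset_Icc_self hy)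
  simpa using h1.unique h2

lemma h1_ac {v v' : ℝ → ℝ} (H : IsH1 v v') : AbsolutelyContinuousOnInterval
    (fun x => v 0 + ∫ t in (0:ℝ)..x, v' t) 0 1 := by
  have h0 : AbsolutelyContinuousOnInterval (fun _ : ℝ => v 0) 0 1 :=
    ContDiffOn.absolutelyContinuousOnInterval contDiffOn_const
  exact h0.add (H.2.1.absolutelyContinuousOnInterval_intervalIntegral (c := 0) (by simp))

lemma int_sq {v v' : ℝ → ℝ} (H : IsH1 v v') (m : ℕ) {p q : ℝ} (hp : 0 ≤ p) (hpq : p ≤ q)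
    (hq : q ≤ 1) : IntervalIntegrable (fun r => r ^ m * v' r ^ 2) volume p q := by
  have h1 : IntervalIntegrable (fun t => v' t ^ 2) volume 0 1 := by
    rw [intervalIntegrable_iff_integrableOn_Ioo_of_le zero_le_one]; exact H.2.2.1
  have h2 := h1.mono_set (c := p) (d := q) (by
    rw [uIcc_of_le hpq, uIcc_of_le zero_le_one]; exact Icc_subset_Icc hp hq)
  exact h2.continuousOn_mul (by fun_prop)

lemma int_v {v v' : ℝ → ℝ} (H : IsH1 v v') (m : ℕ) {p q : ℝ} (hp : 0 ≤ p) (hpq : p ≤ q)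
    (hq : q ≤ 1) : IntervalIntegrable (fun r => r ^ m * v r ^ 2) volume p q := by
  apply ContinuousOn.intervalIntegrable
  rw [uIcc_of_le hpq]
  have := H.1.mono (Icc_subset_Icc hp hq)
  fun_prop

/-- Riccati identity on the middle interval. -/
lemma middle {v v' : ℝ → ℝ} (H : IsH1 v v') (k : ℕ) {h δ : ℝ} (p : ℝ → ℝ)
    (hh0 : 0 < h) (hh1 : h < 1/2)
    (hpc : ContDiffOn ℝ 1 p (Icc h (1 - h)))
    (hp : ∀ r ∈ Icc h (1 - h), HasDerivAt p ((δ ^ 2 + (p r - ((k:ℝ) + 1) / 2) ^ 2) / r) r) :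
    (∫ r in h..(1 - h), r ^ (k + 2) * v' r ^ 2)
      - (((k:ℝ) + 1) ^ 2 / 4 + δ ^ 2) * (∫ r in h..(1 - h), r ^ k * v r ^ 2)
    = h ^ (k + 1) * p h * v h ^ 2 - (1 - h) ^ (k + 1) * p (1 - h) * v (1 - h) ^ 2
      + ∫ r in h..(1 - h), r ^ k * (r * v' r + p r * v r) ^ 2 := by
  set l := ((k:ℝ) + 1) ^ 2 / 4 + δ ^ 2 with hl
  set u : ℝ → ℝ := fun x => v 0 + ∫ t in (0:ℝ)..x, v' t with hu
  have huv : ∀ x ∈ Icc (0:ℝ) 1, v x = u x := H.2.2.2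
  have hle : h ≤ 1 - h := by linarith
  have hsub : Icc h (1 - h) ⊆ Icc (0:ℝ) 1 := Icc_subset_Icc hh0.le (by linarith)
  have huac : AbsolutelyContinuousOnInterval u h (1 - h) := (h1_ac H).mono (by
    rw [uIcc_of_le hle, uIcc_of_le zero_le_one]; exact hsub)
  have hwac : AbsolutelyContinuousOnInterval (fun r => -(r ^ (k + 1) * p r)) h (1 - h) := by
    apply ContDiffOn.absolutelyContinuousOnInterval
    rw [uIcc_of_le hle]
    exact ((contDiff_id.pow (k + 1)).contDiffOn.mul hpc).neg
  have hF := hwac.fun_mul (huac.fun_mul huac)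
  have hFi := hF.integral_deriv_eq_sub
  have hFint := hF.intervalIntegrable_deriv
  have hae : ∀ᵐ x : ℝ, x ∈ uIoc h (1 - h) →
      x ^ k * (x * v' x + p x * v x) ^ 2 =
      x ^ (k + 2) * v' x ^ 2 - l * (x ^ k * v x ^ 2)
        - deriv (fun r => -(r ^ (k + 1) * p r) * (u r * u r)) x := by
    filter_upwards [ae_deriv H, (volume : Measure ℝ).ae_ne (1 - h)] with x hx hxq hxI
    rw [uIoc_of_le hle] at hxI
    have hlt : x < 1 - h := lt_of_le_of_ne hxI.2 hxq
    have hx0 : 0 < x := hh0.trans hxI.1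
    have hxI' : x ∈ Icc h (1 - h) := ⟨hxI.1.le, hxI.2⟩
    have h1 := hx ⟨hx0, by linarith⟩
    have hu1 : HasDerivAt u (v' x) x := by
      refine h1.congr_of_eventuallyEq ?_
      filter_upwards [Ioo_mem_nhds hx0 (show x < 1 by linarith)] with y hy
      exact (huv y (Ioo_subset_Icc_self hy)).symm
    have hD := (((hasDerivAt_pow (k + 1) x).mul (hp x hxI')).neg).mul (hu1.mul hu1)
    have hD' := hD.deriv
    rw [← huv x (hsub hxI')] at hD'
    have e : deriv (fun r => -(r ^ (k + 1) * p r) * (u r * u r)) x = _ := hD'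
    rw [e, hl]
    simp only [Pi.mul_apply, Pi.neg_apply, ← huv x (hsub hxI')]
    push_cast
    have hk : x ^ (k + 1) = x ^ k * x := pow_succ _ _
    have hk2 : x ^ (k + 2) = x ^ k * x ^ 2 := pow_add _ _ _
    rw [hk, hk2]
    field_simp
    ring
  have hI1 := int_sq H (k + 2) hh0.le hle (by linarith : 1 - h ≤ 1)
  have hI2 := int_v H k hh0.le hle (by linarith : 1 - h ≤ 1)
  rw [intervalIntegral.integral_congr_ae hae, intervalIntegral.integral_sub
    (hI1.sub (hI2.const_mul l)) hFint, intervalIntegral.integral_sub hI1 (hI2.const_mul l),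
    intervalIntegral.integral_const_mul, hFi, ← huv h (hsub ⟨le_rfl, hle⟩),
    ← huv (1 - h) (hsub ⟨hle, le_rfl⟩)]
  ring

lemma left_int {v v' : ℝ → ℝ} (H : IsH1 v v') (k : ℕ) {h l a b : ℝ}
    (hh0 : 0 < h) (hh1 : h < 1/2) (hv : ∀ x ∈ Icc (0:ℝ) h, v x = a * x + b) :
    (∫ r in (0:ℝ)..h, r ^ (k + 2) * v' r ^ 2) - l * (∫ r in (0:ℝ)..h, r ^ k * v r ^ 2)
    = h ^ (k + 1) * ((a * h) ^ 2 / (k + 3) - l * ((a * h) ^ 2 / (k + 3)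
        + 2 * (a * h) * b / (k + 2) + b ^ 2 / (k + 1))) := by
  have e1 : (∫ r in (0:ℝ)..h, r ^ (k + 2) * v' r ^ 2) = ∫ r in (0:ℝ)..h, r ^ (k + 2) * a ^ 2 := by
    apply intervalIntegral.integral_congr_ae
    filter_upwards [affine_ae H le_rfl (by linarith : h ≤ 1) hv] with x hx hxI
    rw [uIoc_of_le hh0.le] at hxI
    rw [hx hxI]
  have e2 : (∫ r in (0:ℝ)..h, r ^ k * v r ^ 2)
      = ∫ r in (0:ℝ)..h, (a ^ 2 * r ^ (k + 2) + 2 * a * b * r ^ (k + 1) + b ^ 2 * r ^ k) := by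
    apply intervalIntegral.integral_congr
    intro x hx
    rw [uIcc_of_le hh0.le] at hx
    simp only [hv x hx]
    ring
  have ii : ∀ m : ℕ, ∀ c : ℝ, IntervalIntegrable (fun r : ℝ => c * r ^ m) volume 0 h := fun m c =>
    Continuous.intervalIntegrable (by fun_prop) _ _
  rw [e1, e2, intervalIntegral.integral_add ((ii _ _).add (ii _ _)) (ii _ _),
    intervalIntegral.integral_add (ii _ _) (ii _ _)]
  simp only [intervalIntegral.integral_const_mul, intervalIntegral.integral_mul_const, integral_pow]
  push_cast
  have : (k:ℝ) + 1 ≠ 0 := by positivity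
  have : (k:ℝ) + 2 ≠ 0 := by positivity
  have : (k:ℝ) + 3 ≠ 0 := by positivity
  have : (k:ℝ) + 1 + 1 = k + 2 := by ring
  rw [this]
  have : (k:ℝ) + 2 + 1 = k + 3 := by ring
  rw [this]
  simp only [zero_pow (Nat.succ_ne_zero _)]
  field_simp
  ring

lemma fm_eq (k m : ℕ) (hm : 0 < m) {h : ℝ} (hh0 : 0 < h) (hh1 : h < 1/2) :
    h * (1 - h) ^ (k + 1) * fm (k + 3) m h = (1 - (1 - h) ^ m) / m := by
  unfold fm
  have h1 : (1 - h) ≠ 0 := by linarith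
  have e : ∀ i : ℕ, (1 - h) ^ ((2:ℤ) - ((k + 3 : ℕ) : ℤ) + (i:ℤ))
      = ((1 - h) ^ (k + 1))⁻¹ * (1 - h) ^ i := by
    intro i
    have : (2:ℤ) - ((k + 3 : ℕ) : ℤ) + (i:ℤ) = -((k + 1 : ℕ) : ℤ) + (i:ℤ) := by push_cast; ring
    rw [this, zpow_add₀ h1, zpow_neg, zpow_natCast, zpow_natCast]
  simp only [e]
  rw [← Finset.mul_sum]
  have g := geom_sum_mul (1 - h) m
  have g' : (∑ i ∈ Finset.range m, (1 - h) ^ i) * h = 1 - (1 - h) ^ m := by linarith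
  have : (m:ℝ) ≠ 0 := by positivity
  rw [← g']
  field_simp

lemma right_int {v v' : ℝ → ℝ} (H : IsH1 v v') (k : ℕ) {h l : ℝ}
    (hh0 : 0 < h) (hh1 : h < 1/2) (hv1 : v 1 = 0)
    (hv : ∃ a b : ℝ, ∀ x ∈ Icc (1 - h) (1:ℝ), v x = a * x + b) :
    (∫ r in (1 - h)..1, r ^ (k + 2) * v' r ^ 2) - l * (∫ r in (1 - h)..1, r ^ k * v r ^ 2)
    = (1 - h) ^ (k + 1) * ((1 / h) * (fm (k + 3) (k + 3) h - gn (k + 3) h * l)) * v (1 - h) ^ 2 := by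
  obtain ⟨a, b, hv⟩ := hv
  have hle : 1 - h ≤ 1 := by linarith
  have hb : b = -a := by have := hv 1 ⟨hle, le_rfl⟩; linarith
  subst hb
  have e1 : (∫ r in (1 - h)..1, r ^ (k + 2) * v' r ^ 2) = ∫ r in (1 - h)..1, r ^ (k + 2) * a ^ 2 := by
    apply intervalIntegral.integral_congr_ae
    filter_upwards [affine_ae H (by linarith : 0 ≤ 1 - h) le_rfl hv] with x hx hxI
    rw [uIoc_of_le hle] at hxI
    rw [hx hxI]
  have e2 : (∫ r in (1 - h)..1, r ^ k * v r ^ 2)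
      = ∫ r in (1 - h)..1, (a ^ 2 * r ^ (k + 2) + (- 2 * a ^ 2) * r ^ (k + 1) + a ^ 2 * r ^ k) := by
    apply intervalIntegral.integral_congr
    intro x hx
    rw [uIcc_of_le hle] at hx
    simp only [hv x hx]
    ring
  have ii : ∀ m : ℕ, ∀ c : ℝ, IntervalIntegrable (fun r : ℝ => c * r ^ m) volume (1 - h) 1 :=
    fun m c => Continuous.intervalIntegrable (by fun_prop) _ _
  have f1 := fm_eq k (k + 1) (by positivity) hh0 hh1
  have f2 := fm_eq k (k + 2) (by positivity) hh0 hh1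
  have f3 := fm_eq k (k + 3) (by positivity) hh0 hh1
  have P : ∀ m : ℕ, ∫ r in (1 - h)..1, r ^ m = (1 - (1 - h) ^ (m + 1)) / ((m + 1 : ℕ) : ℝ) := by
    intro m; rw [integral_pow]; simp
  rw [e1, e2, intervalIntegral.integral_add ((ii _ _).add (ii _ _)) (ii _ _),
    intervalIntegral.integral_add (ii _ _) (ii _ _)]
  simp only [intervalIntegral.integral_const_mul, intervalIntegral.integral_mul_const, P]
  rw [← f1, ← f2, ← f3, hv (1 - h) ⟨le_rfl, hle⟩]
  unfold gn
  simp only [show k + 3 - 1 = k + 2 from rfl, show k + 3 - 2 = k + 1 from rfl]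
  field_simp
  ring

/-- The full identity. -/
lemma full {v v' : ℝ → ℝ} (k : ℕ) {h δ a b : ℝ} (p : ℝ → ℝ)
    (hh0 : 0 < h) (hh1 : h < 1/2)
    (hpc : ContDiffOn ℝ 1 p (Icc h (1 - h)))
    (hp : ∀ r ∈ Icc h (1 - h), HasDerivAt p ((δ ^ 2 + (p r - ((k:ℝ) + 1) / 2) ^ 2) / r) r)
    (hp1 : p (1 - h) = (1 / h) * (fm (k + 3) (k + 3) h
      - gn (k + 3) h * (((k:ℝ) + 1) ^ 2 / 4 + δ ^ 2)))
    (H : MemWh h v v') (hv : ∀ x ∈ Icc (0:ℝ) h, v x = a * x + b) :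
    (∫ r in (0:ℝ)..1, r ^ (k + 2) * v' r ^ 2)
      - (((k:ℝ) + 1) ^ 2 / 4 + δ ^ 2) * (∫ r in (0:ℝ)..1, r ^ k * v r ^ 2)
    = h ^ (k + 1) * ((a * h) ^ 2 / (k + 3) - (((k:ℝ) + 1) ^ 2 / 4 + δ ^ 2) * ((a * h) ^ 2 / (k + 3)
        + 2 * (a * h) * b / (k + 2) + b ^ 2 / (k + 1)) + p h * (a * h + b) ^ 2)
      + ∫ r in h..(1 - h), r ^ k * (r * v' r + p r * v r) ^ 2 := by
  obtain ⟨H1, hv1, -, hvr⟩ := H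
  have A := left_int H1 k (l := ((k:ℝ) + 1) ^ 2 / 4 + δ ^ 2) hh0 hh1 hv
  have B := middle H1 k p hh0 hh1 hpc hp
  have C := right_int H1 k (l := ((k:ℝ) + 1) ^ 2 / 4 + δ ^ 2) hh0 hh1 hv1 hvr
  rw [← hp1] at C
  rw [hv h ⟨hh0.le, le_rfl⟩] at B
  have i1 := intervalIntegral.integral_add_adjacent_intervals
    (int_sq H1 (k + 2) le_rfl hh0.le (by linarith))
    (int_sq H1 (k + 2) hh0.le (by linarith : h ≤ 1 - h) (by linarith))
  have i2 := intervalIntegral.integral_add_adjacent_intervals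
    (int_sq H1 (k + 2) le_rfl (by linarith : 0 ≤ 1 - h) (by linarith))
    (int_sq H1 (k + 2) (by linarith : 0 ≤ 1 - h) (by linarith) le_rfl)
  have j1 := intervalIntegral.integral_add_adjacent_intervals
    (int_v H1 k le_rfl hh0.le (by linarith))
    (int_v H1 k hh0.le (by linarith : h ≤ 1 - h) (by linarith))
  have j2 := intervalIntegral.integral_add_adjacent_intervals
    (int_v H1 k le_rfl (by linarith : 0 ≤ 1 - h) (by linarith))
    (int_v H1 k (by linarith : 0 ≤ 1 - h) (by linarith) le_rfl)
  rw [← i2, ← i1, ← j2, ← j1]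
  linear_combination A + B + C

lemma quad_eq {k : ℝ} {l K A V p : ℝ} (hk : 0 ≤ k) (hK : 0 < K)
    (hKl : K = (k + 2) * (k + 1) - 2 * l)
    (hdeg : K * (p * (k + 1) - l) * (k + 2) = (k + 3) * l ^ 2) :
    A ^ 2 / (k + 3) - l * (A ^ 2 / (k + 3) + 2 * A * (V - A) / (k + 2) + (V - A) ^ 2 / (k + 1))
      + p * V ^ 2
    = K / ((k + 3) * (k + 2) * (k + 1)) * (A + (k + 3) * l / K * V) ^ 2 := by
  have h1 : k + 1 ≠ 0 := by positivity
  have h2 : k + 2 ≠ 0 := by positivity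
  have h3 : k + 3 ≠ 0 := by positivity
  have hp : p = ((k + 3) * l ^ 2 / (K * (k + 2)) + l) / (k + 1) := by
    field_simp
    linear_combination hdeg
  rw [hp]
  field_simp
  rw [hKl]
  ring

lemma D_pos {h : ℝ} {v v' : ℝ → ℝ} (k : ℕ) (hh0 : 0 < h) (hh1 : h < 1/2) (H : MemWh h v v')
    (hne : ∃ x ∈ Icc (0:ℝ) 1, v x ≠ 0) : 0 < ∫ r in (0:ℝ)..1, r ^ k * v r ^ 2 := by
  have hne' : ∃ x ∈ Icc (0:ℝ) 1, 0 < x ∧ v x ≠ 0 := by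
    by_contra! hcon
    obtain ⟨a, b, hv⟩ := H.2.2.1
    have e1 := hcon h ⟨hh0.le, by linarith⟩ hh0
    have e2 := hcon (h / 2) ⟨by linarith, by linarith⟩ (by linarith)
    rw [hv h ⟨hh0.le, le_rfl⟩] at e1
    rw [hv (h / 2) ⟨by linarith, by linarith⟩] at e2
    have hb : b = 0 := by linarith
    obtain ⟨x, hx, hvx⟩ := hne
    rcases hx.1.eq_or_lt with h0 | h0
    · apply hvx
      rw [← h0, hv 0 ⟨le_rfl, hh0.le⟩, hb]; ring
    · exact hvx (hcon x hx h0)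
  obtain ⟨x, hx, hx0, hvx⟩ := hne'
  apply intervalIntegral.integral_pos zero_lt_one
  · have := H.1.1
    fun_prop
  · intro y hy
    have := hy.1
    positivity
  · exact ⟨x, hx, by positivity⟩

/-- The minimizer. -/
lemma exists_min {h a : ℝ} (hh0 : 0 < h) (hh1 : h < 1/2) (φ φ' : ℝ → ℝ)
    (hφ : ∀ r ∈ Icc h (1 - h), HasDerivAt φ (φ' r) r) (hφc : ContinuousOn φ' (Icc h (1 - h))) :
    ∃ v v' : ℝ → ℝ, MemWh h v v' ∧ (∀ x ∈ Icc (0:ℝ) h, v x = a * x + (φ h - a * h)) ∧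
      (∀ x ∈ Ioo h (1 - h), v x = φ x ∧ v' x = φ' x) ∧ v h = φ h := by
  have hle : h ≤ 1 - h := by linarith
  have hle1 : 1 - h ≤ 1 := by linarith
  set c := φ (1 - h) / h with hc
  have hch : c * h = φ (1 - h) := by rw [hc]; field_simp
  set w : ℝ → ℝ := fun x => if x < h then a else if x < 1 - h then φ' x else -c with hw
  have w1 : ∀ x ∈ Ioo 0 h, w x = a := fun x hx => by simp [hw, hx.2]
  have w2 : ∀ x ∈ Ioo h (1 - h), w x = φ' x := fun x hx => by
    simp [hw, hx.2, not_lt.2 hx.1.le]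
  have w3 : ∀ x ∈ Ioo (1 - h) 1, w x = -c := fun x hx => by
    simp only [hw]; rw [if_neg (by linarith [hx.1]), if_neg (by linarith [hx.1])]
  have hint : ∀ F : ℝ → ℝ, Continuous F → IntervalIntegrable (fun x => F (w x)) volume 0 1 := by
    intro F hF
    have i1 : IntervalIntegrable (fun x => F (w x)) volume 0 h := by
      refine (intervalIntegrable_const (c := F a)).congr_uIoo ?_
      intro x hx; rw [uIoo_of_le hh0.le] at hx; simp only [w1 x hx]
    have i2 : IntervalIntegrable (fun x => F (w x)) volume h (1 - h) := by
      have : IntervalIntegrable (fun x => F (φ' x)) volume h (1 - h) := by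
        apply ContinuousOn.intervalIntegrable
        rw [uIcc_of_le hle]
        exact hF.comp_continuousOn hφc
      refine this.congr_uIoo ?_
      intro x hx; rw [uIoo_of_le hle] at hx; simp only [w2 x hx]
    have i3 : IntervalIntegrable (fun x => F (w x)) volume (1 - h) 1 := by
      refine (intervalIntegrable_const (c := F (-c))).congr_uIoo ?_
      intro x hx; rw [uIoo_of_le hle1] at hx; simp only [w3 x hx]
    exact (i1.trans i2).trans i3
  have hwi : IntervalIntegrable w volume 0 1 := hint id continuous_id
  have hsub : ∀ {s t : ℝ}, 0 ≤ s → s ≤ t → t ≤ 1 → IntervalIntegrable w volume s t := by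
    intro s t hs hst ht
    refine hwi.mono_set ?_
    rw [uIcc_of_le hst, uIcc_of_le zero_le_one]; exact Icc_subset_Icc hs ht
  set v : ℝ → ℝ := fun x => (φ h - a * h) + ∫ t in (0:ℝ)..x, w t with hv
  have v0 : v 0 = φ h - a * h := by simp [hv]
  have v1 : ∀ x ∈ Icc (0:ℝ) h, v x = a * x + (φ h - a * h) := by
    intro x hx
    have : ∫ t in (0:ℝ)..x, w t = ∫ t in (0:ℝ)..x, a := by
      apply intervalIntegral.integral_congr_Ioo_of_le hx.1
      intro y hy; exact w1 y ⟨hy.1, hy.2.trans_le hx.2⟩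
    simp only [hv]
    rw [this]; simp; ring
  have vh : v h = φ h := by rw [v1 h ⟨hh0.le, le_rfl⟩]; ring
  have v2 : ∀ x ∈ Icc h (1 - h), v x = φ x := by
    intro x hx
    have e := intervalIntegral.integral_add_adjacent_intervals
      (hsub le_rfl hh0.le (by linarith)) (hsub hh0.le hx.1 (by linarith [hx.2]))
    have : ∫ t in h..x, w t = ∫ t in h..x, φ' t := by
      apply intervalIntegral.integral_congr_Ioo_of_le hx.1
      intro y hy; exact w2 y ⟨hy.1, hy.2.trans_le hx.2⟩
    have e2 : ∫ t in h..x, φ' t = φ x - φ h := by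
      apply intervalIntegral.integral_eq_sub_of_hasDerivAt
      · intro y hy; rw [uIcc_of_le hx.1] at hy; exact hφ y ⟨hy.1, hy.2.trans hx.2⟩
      · apply ContinuousOn.intervalIntegrable
        rw [uIcc_of_le hx.1]; exact hφc.mono (Icc_subset_Icc le_rfl hx.2)
    have e3 : v x = v h + ∫ t in h..x, w t := by simp only [hv]; rw [← e]; ring
    rw [e3, vh, this, e2]; ring
  have v3 : ∀ x ∈ Icc (1 - h) 1, v x = (-c) * x + c := by
    intro x hx
    have e := intervalIntegral.integral_add_adjacent_intervals
      (hsub le_rfl (by linarith : 0 ≤ 1 - h) hle1) (hsub (by linarith : 0 ≤ 1 - h) hx.1 hx.2)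
    have : ∫ t in (1 - h)..x, w t = ∫ t in (1 - h)..x, -c := by
      apply intervalIntegral.integral_congr_Ioo_of_le hx.1
      intro y hy; exact w3 y ⟨hy.1, hy.2.trans_le hx.2⟩
    have e3 : v x = v (1 - h) + ∫ t in (1 - h)..x, w t := by simp only [hv]; rw [← e]; ring
    rw [e3, this, v2 (1 - h) ⟨hle, le_rfl⟩, ← hch]
    simp; ring
  have hH1 : IsH1 v w := by
    refine ⟨?_, hwi, ?_, ?_⟩
    · have := (hwi.absolutelyContinuousOnInterval_intervalIntegral (c := 0) (by simp)).continuousOn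
      rw [uIcc_of_le zero_le_one] at this
      exact continuousOn_const.add this
    · have := hint (fun y => y ^ 2) (by fun_prop)
      rwa [intervalIntegrable_iff_integrableOn_Ioo_of_le zero_le_one] at this
    · intro x _; rw [v0]
  refine ⟨v, w, ⟨hH1, ?_, ⟨_, _, v1⟩, ⟨_, _, v3⟩⟩, v1, ?_, vh⟩
  · rw [v3 1 ⟨hle1, le_rfl⟩]; ring
  · intro x hx; exact ⟨v2 x (Ioo_subset_Icc_self hx), w2 x hx⟩

/-- If `(δ,γ)` solves the system at `(n,h)`, then `μ_h^n = S^n + δ²`. -/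
theorem munh_eq (n : ℕ) (hn : 3 ≤ n) (h δ γ : ℝ) (hh0 : 0 < h) (hh1 : h < 1/2)
    (hsol : SolvesSystem n h δ γ) :
    munh n h = ((n : ℝ) - 2) ^ 2 / 4 + δ ^ 2 := by
  obtain ⟨k, rfl⟩ : ∃ k, n = k + 3 := ⟨n - 3, by omega⟩
  obtain ⟨hδ, hδn, hθ, hs1, hs2⟩ := hsol
  have hcast : (((k + 3 : ℕ) : ℝ) - 2) = (k:ℝ) + 1 := by push_cast; ring
  have hcast1 : (((k + 3 : ℕ) : ℝ) - 1) = (k:ℝ) + 2 := by push_cast; ring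
  have hcast0 : ((k + 3 : ℕ) : ℝ) = (k:ℝ) + 3 := by push_cast; ring
  rw [hcast] at hs1 hs2 hδn ⊢
  rw [hcast1] at hs1
  rw [hcast0] at hs1 hδn
  have hk : (0:ℝ) ≤ k := Nat.cast_nonneg k
  have hle : h ≤ 1 - h := by linarith
  set l := ((k:ℝ) + 1) ^ 2 / 4 + δ ^ 2 with hl
  set p : ℝ → ℝ := fun r => ((k:ℝ) + 1) / 2 + δ * tan (γ + δ * log r) with hpdef
  have hcos : ∀ r ∈ Icc h (1 - h), 0 < cos (γ + δ * log r) := fun r hr =>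
    cos_pos_of_mem_Ioo (hθ r hr)
  have hr0 : ∀ r ∈ Icc h (1 - h), 0 < r := fun r hr => hh0.trans_le hr.1
  have hθd : ∀ r ∈ Icc h (1 - h), HasDerivAt (fun r => γ + δ * log r) (δ * r⁻¹) r := fun r hr =>
    ((hasDerivAt_log (hr0 r hr).ne').const_mul δ).const_add γ
  have hp : ∀ r ∈ Icc h (1 - h),
      HasDerivAt p ((δ ^ 2 + (p r - ((k:ℝ) + 1) / 2) ^ 2) / r) r := by
    intro r hr
    have hc := (hcos r hr).ne'
    have hr' := (hr0 r hr).ne'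
    have := (((hasDerivAt_tan hc).comp r (hθd r hr)).const_mul δ).const_add (((k:ℝ) + 1) / 2)
    refine (show HasDerivAt p _ r from this).congr_deriv (Eq.symm ?_)
    simp only [hpdef, tan_eq_sin_div_cos]
    field_simp
    linear_combination 4 * δ ^ 2 * (sin_sq_add_cos_sq (γ + δ * log r))
  have hpc : ContDiffOn ℝ 1 p (Icc h (1 - h)) := by
    intro r hr
    apply ContDiffAt.contDiffWithinAt
    have h1 : ContDiffAt ℝ 1 (fun r => γ + δ * log r) r :=
      contDiffAt_const.add (contDiffAt_const.mul (contDiffAt_log.2 (hr0 r hr).ne'))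
    have h2 : ContDiffAt ℝ 1 tan (γ + δ * log r) := contDiffAt_tan.2 (hcos r hr).ne'
    exact contDiffAt_const.add (contDiffAt_const.mul (ContDiffAt.comp (g := tan) r h2 h1))
  have hp1 : p (1 - h) = (1 / h) * (fm (k + 3) (k + 3) h - gn (k + 3) h * l) := hs2
  set K : ℝ := ((k:ℝ) + 2) * (k + 1) - 2 * l with hK
  have hKe : (((k:ℝ) + 3) ^ 2 - 2 * (k + 3)) / 2 - 2 * δ ^ 2 = K := by rw [hK, hl]; ring
  rw [hKe] at hs1
  have hKpos : 0 < K := by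
    have h0 : 0 ≤ K := by rw [← hKe]; nlinarith
    rcases h0.eq_or_lt with h00 | h00
    · rw [← h00, zero_mul] at hs1
      have : 0 < ((k:ℝ) + 1) / (k + 2) * (((k:ℝ) + 3) ^ 2 / 4 + δ ^ 2) ^ 2 := by positivity
      linarith
    · exact h00
  have hdeg : K * (p h * (k + 1) - l) * (k + 2) = (k + 3) * l ^ 2 := by
    have h1 : (k:ℝ) + 1 ≠ 0 := by positivity
    have h2 : (k:ℝ) + 2 ≠ 0 := by positivity
    have h3 : (k:ℝ) + 3 ≠ 0 := by positivity
    set T := tan (γ + δ * log h) with hT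
    have hph : p h = ((k:ℝ) + 1) / 2 + δ * T := rfl
    have hs1' : K * (((k:ℝ) + 3) ^ 2 / 4 - δ ^ 2 + (k + 3) * δ * T) * (k + 2)
        = (k + 1) * (((k:ℝ) + 3) ^ 2 / 4 + δ ^ 2) ^ 2 := by
      rw [hs1]; field_simp
    apply mul_left_cancel₀ h3
    rw [hph]
    have hKl : K = ((k:ℝ) + 2) * (k + 1) - 2 * (((k:ℝ) + 1) ^ 2 / 4 + δ ^ 2) := hK
    rw [hl]
    rw [hKl] at hs1' ⊢
    linear_combination ((k:ℝ) + 1) * hs1'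
  unfold munh
  simp only [show k + 3 - 1 = k + 2 from rfl, show k + 3 - 3 = k from rfl]
  apply IsLeast.csInf_eq
  constructor
  · -- the minimizer
    set φ : ℝ → ℝ := fun r => exp (-((k:ℝ) + 1) / 2 * log r) * cos (γ + δ * log r) with hφdef
    have hφ : ∀ r ∈ Icc h (1 - h), HasDerivAt φ (-(p r * φ r / r)) r := by
      intro r hr
      have hc := (hcos r hr).ne'
      have hr' := (hr0 r hr).ne'
      have h1 := (((hasDerivAt_log hr').const_mul (-((k:ℝ) + 1) / 2)).exp).mul
        ((hasDerivAt_cos _).comp r (hθd r hr))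
      refine (show HasDerivAt φ _ r from h1).congr_deriv (Eq.symm ?_)
      simp only [hpdef, hφdef, tan_eq_sin_div_cos, Function.comp]
      field_simp
      ring
    have hφc : ContinuousOn (fun r => -(p r * φ r / r)) (Icc h (1 - h)) := by
      have c1 : ContinuousOn p (Icc h (1 - h)) := hpc.continuousOn
      have c2 : ContinuousOn φ (Icc h (1 - h)) := fun r hr =>
        (hφ r hr).continuousAt.continuousWithinAt
      exact ((c1.mul c2).div continuousOn_id (fun r hr => (hr0 r hr).ne')).neg
    obtain ⟨v, v', hm, hv1, hv2, hvh⟩ := exists_min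
      (a := -(((k:ℝ) + 3) * l / K * φ h) / h) hh0 hh1 φ _ hφ hφc
    have hφh : 0 < φ h := mul_pos (exp_pos _) (hcos h ⟨le_rfl, hle⟩)
    have hne : ∃ x ∈ Icc (0:ℝ) 1, v x ≠ 0 :=
      ⟨h, ⟨hh0.le, by linarith⟩, by rw [hvh]; exact hφh.ne'⟩
    have hD := D_pos k hh0 hh1 hm hne
    refine ⟨v, v', hm, hne, ?_⟩
    have hfull := full k p hh0 hh1 hpc hp hp1 hm hv1
    rw [← hl, add_sub_cancel, quad_eq (A := _) (V := φ h) hk hKpos hK hdeg] at hfull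
    have hA : -(((k:ℝ) + 3) * l / K * φ h) / h * h = -(((k:ℝ) + 3) * l / K * φ h) := by
      field_simp
    have hz : ∫ r in h..(1 - h), r ^ k * (r * v' r + p r * v r) ^ 2 = ∫ r in h..(1 - h), (0:ℝ) := by
      apply intervalIntegral.integral_congr_Ioo_of_le hle
      intro r hr
      have hr' := (hr0 r (Ioo_subset_Icc_self hr)).ne'
      simp only [(hv2 r hr).1, (hv2 r hr).2]
      field_simp
      ring
    rw [hz, hA] at hfull
    simp at hfull
    rw [eq_div_iff hD.ne']
    linarith
  · rintro s ⟨v, v', hm, hne, rfl⟩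
    have hD := D_pos k hh0 hh1 hm hne
    obtain ⟨a, b, hv⟩ := hm.2.2.1
    have hfull := full k p hh0 hh1 hpc hp hp1 hm hv
    have hb : b = (a * h + b) - a * h := by ring
    have hq := quad_eq (A := a * h) (V := a * h + b) hk hKpos hK hdeg
    rw [← hb] at hq
    rw [← hl, hq] at hfull
    have hR : 0 ≤ ∫ r in h..(1 - h), r ^ k * (r * v' r + p r * v r) ^ 2 := by
      apply intervalIntegral.integral_nonneg hle
      intro r hr
      have := hr0 r hr
      positivity
    have hP : 0 ≤ h ^ (k + 1) * (K / (((k:ℝ) + 3) * (k + 2) * (k + 1))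
        * (a * h + (k + 3) * l / K * (a * h + b)) ^ 2) := by positivity
    rw [le_div_iff₀ hD]
    linarith
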